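/- arXiv:0706.1720 — 2 statements merged into one kernel-verified Lean document; each statement's English description precedes it below -/
import Mathlib

section
/- Let v ≥ 9 be an odd integer. Then there exist nonnegative integers a and b and a natural number t such that a*(v+1) + b*(v-3) = 2^t. -/
/-- Corollary 7: for odd `v ≥ 9`, some power of 2 is a nonnegative integer
combination of `v+1` and `v-3`. -/
theorem pow_two_eq_comb (v : ℤ) (hodd : Odd v) (hv : v ≥ 9) :
    ∃ a b : ℤ, 0 ≤ a ∧ 0 ≤ b ∧ ∃ t : ℕ, a * (v + 1) + b * (v - 3) = 2 ^ t := by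
  obtain ⟨k, rfl⟩ := hodd
  obtain ⟨m, hm⟩ : ∃ m : ℕ, k = m + 1 := ⟨(k - 1).toNat, by omega⟩
  subst hm
  have hm0 : (0 : ℤ) < m := by omega
  -- Divide a power of two exceeding `m ^ 2` by `m`: the remainder is at most the quotient.
  have hpow : (m : ℤ) * m ≤ 2 ^ (2 * m) := by
    have h : (m : ℤ) < 2 ^ m := mod_cast Nat.lt_two_pow_self
    rw [two_mul, pow_add]
    gcongr
  have hq : (m : ℤ) ≤ 2 ^ (2 * m) / m := (Int.le_ediv_iff_mul_le hm0).2 hpow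
  have hr := Int.emod_nonneg (2 ^ (2 * m) : ℤ) hm0.ne'
  have hlt := Int.emod_lt_of_pos (2 ^ (2 * m) : ℤ) hm0
  have hdiv := Int.mul_ediv_add_emod (2 ^ (2 * m) : ℤ) m
  refine ⟨2 ^ (2 * m) % m, 2 * (2 ^ (2 * m) / m) - 2 ^ (2 * m) % m, hr, by linarith,
    2 * m + 2, ?_⟩
  rw [pow_add]
  linear_combination 4 * hdiv
end

section
/- Let n > 2 be a natural number and let H be an n × n matrix with real entries all equal to 1 or -1 such that H * Hᵀ = n • I, where I is the n × n identity matrix. Then n is divisible by 4. -/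
/-- The order of an Hadamard matrix of order `n > 2` is divisible by 4. -/
theorem hadamard_order_div_four (n : ℕ) (hn : n > 2)
    (H : Matrix (Fin n) (Fin n) ℝ)
    (hentries : ∀ i j, H i j = 1 ∨ H i j = -1)
    (hH : H * H.transpose = (n : ℝ) • (1 : Matrix (Fin n) (Fin n) ℝ)) :
    4 ∣ n := by
  have hdot (i k : Fin n) : ∑ j, H i j * H k j = if i = k then (n : ℝ) else 0 := by
    simpa [Matrix.mul_apply, Matrix.one_apply] using congrFun₂ hH i k
  let a : Fin n := ⟨0, by omega⟩
  let b : Fin n := ⟨1, by omega⟩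
  let c : Fin n := ⟨2, hn⟩
  have hsum : ∑ j, (H a j + H b j) * (H a j + H c j) = n := by
    simp only [add_mul, mul_add, Finset.sum_add_distrib, hdot]
    simp [a, b, c]
  have hterm (j : Fin n) : ∃ m : ℤ, (H a j + H b j) * (H a j + H c j) = 4 * m := by
    rcases hentries a j with ha | ha <;> rcases hentries b j with hb | hb <;>
      rcases hentries c j with hc | hc <;> rw [ha, hb, hc] <;>
      first
      | (refine ⟨0, ?_⟩; norm_num; done)
      | (refine ⟨1, ?_⟩; norm_num)
  choose m hm using hterm
  have hcast : (n : ℝ) = 4 * ((∑ j, m j : ℤ) : ℝ) := by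
    rw [← hsum, Int.cast_sum, Finset.mul_sum]
    exact Finset.sum_congr rfl fun j _ => hm j
  have hint : (n : ℤ) = 4 * ∑ j, m j := by exact_mod_cast hcast
  omega
end
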